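/- Let α and (α_n) be Borel probability measures on X, and assume the Gibbs kernel k_ε is strictly positive definite. Then the Sinkhorn divergence metrizes the convergence in law: α_n ⇀ α if and only if S_ε(α_n, α) → 0. -/

import Mathlib

open MeasureTheory Real Filter Topology
open scoped NNReal ENNReal

/-- The entropic dual functional `D_ε(α, β; f, g)`. -/
noncomputable def Dfun {X : Type*} [MeasurableSpace X] (eps : ℝ) (C : X → X → ℝ)
    (alpha beta : Measure X) (f g : X → ℝ) : ℝ :=
  (∫ x, f x ∂alpha) + (∫ y, g y ∂beta) -
    eps * ∫ x, ∫ y, (Real.exp ((f x + g y - C x y) / eps) - 1) ∂beta ∂alpha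

/-- The entropic transport cost `OT_ε(α, β)`, as a supremum of the dual
functional over pairs of continuous potentials. -/
noncomputable def OTcost {X : Type*} [TopologicalSpace X] [MeasurableSpace X] (eps : ℝ) (C : X → X → ℝ)
    (alpha beta : Measure X) : ℝ :=
  sSup {r : ℝ | ∃ f g : X → ℝ, Continuous f ∧ Continuous g ∧ r = Dfun eps C alpha beta f g}

/-- The Sinkhorn divergence `S_ε(α, β)`. -/
noncomputable def Sinkhorn {X : Type*} [TopologicalSpace X] [MeasurableSpace X] (eps : ℝ) (C : X → X → ℝ)
    (alpha beta : Measure X) : ℝ :=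
  OTcost eps C alpha beta - (1/2) * OTcost eps C alpha alpha - (1/2) * OTcost eps C beta beta

/-- The squared kernel norm `‖ξ‖²_k = ∫∫ k dξ dξ` of the finite signed measure
`ξ = μ - ν`, written out in terms of its positive and negative parts. -/
noncomputable def kerQuad {X : Type*} [MeasurableSpace X] (k : X → X → ℝ)
    (mu nu : Measure X) : ℝ :=
  ∫ x, ∫ y, k x y ∂mu ∂mu - ∫ x, ∫ y, k x y ∂nu ∂mu
    - ∫ x, ∫ y, k x y ∂mu ∂nu + ∫ x, ∫ y, k x y ∂nu ∂nu

/-- A kernel is strictly positive definite if `‖ξ‖²_k > 0` for every nonzero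
finite signed Borel measure `ξ = μ - ν`. -/
def StrictPosDef {X : Type*} [MeasurableSpace X] (k : X → X → ℝ) : Prop :=
  ∀ mu nu : Measure X, IsFiniteMeasure mu → IsFiniteMeasure nu → mu ≠ nu →
    0 < kerQuad k mu nu

/-- The integral of `exp ((g - C x) / eps)` against `beta`, i.e. the Gibbs kernel applied to the
measure of density `exp (g / eps)` with respect to `beta`. -/
noncomputable def gibbsIntegral {X : Type*} [MeasurableSpace X] (eps : ℝ) (C : X → X → ℝ)
    (beta : Measure X) (g : X → ℝ) (x : X) : ℝ :=
  ∫ y, Real.exp ((g y - C x y) / eps) ∂beta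

/-- The Sinkhorn map, sending a potential to its soft `C`-transform. -/
noncomputable def sinkhornMap {X : Type*} [MeasurableSpace X] (eps : ℝ) (C : X → X → ℝ)
    (beta : Measure X) (g : X → ℝ) (x : X) : ℝ :=
  -eps * Real.log (gibbsIntegral eps C beta g x)

/-- The `kappa`-Lipschitz functions bounded by `M`. -/
def potentialSet (X : Type*) [MetricSpace X] (kappa : ℝ≥0) (M : ℝ) : Set C(X, ℝ) :=
  {f | LipschitzWith kappa f ∧ ∀ x, |f x| ≤ M}

/-- The measure of density `exp (a / eps)` with respect to `alpha`. -/
noncomputable def expMeasure {X : Type*} [MeasurableSpace X] (eps : ℝ) (alpha : Measure X)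
    (a : X → ℝ) : Measure X :=
  alpha.withDensity fun x => ENNReal.ofReal (Real.exp (a x / eps))

theorem isCompact_potentialSet {X : Type*} [MetricSpace X] (kappa : ℝ≥0) (M : ℝ) :
    IsCompact (potentialSet X kappa M) := by
  refine ArzelaAscoli.isCompact_of_equicontinuous _ ?_
    (LipschitzWith.uniformEquicontinuous _ kappa fun f => f.2.1).equicontinuous
  have himage : ContinuousMap.toFun '' potentialSet X kappa M =
      Set.pi Set.univ (fun _ => Set.Icc (-M) M) ∩ {f | LipschitzWith kappa f} := by
    ext f
    constructor
    · rintro ⟨f, hf, rfl⟩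
      exact ⟨fun x _ => abs_le.1 (hf.2 x), hf.1⟩
    · rintro ⟨hb, hl⟩
      exact ⟨⟨f, LipschitzWith.continuous hl⟩, ⟨hl, fun x => abs_le.2 (hb x trivial)⟩, rfl⟩
  rw [himage]
  exact (isCompact_univ_pi fun _ => isCompact_Icc).inter_right
    (isClosed_setOfPred_lipschitzWith kappa)

theorem Continuous.integrable_of_compactSpace {Y : Type*} [TopologicalSpace Y] [CompactSpace Y]
    [MeasurableSpace Y] [OpensMeasurableSpace Y] {mu : Measure Y} [IsFiniteMeasure mu]
    {f : Y → ℝ} (hf : Continuous f) : Integrable f mu :=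
  hf.integrable_of_hasCompactSupport (HasCompactSupport.of_compactSpace f)

theorem continuous_integral_prod {Y : Type*} [TopologicalSpace Y] [CompactSpace Y]
    [MeasurableSpace Y] [OpensMeasurableSpace Y] :
    Continuous fun q : C(Y, ℝ) × ProbabilityMeasure Y => ∫ y, q.1 y ∂(q.2 : Measure Y) := by
  refine continuous_prod_of_continuous_lipschitzWith _ 1
    (fun f => ProbabilityMeasure.continuous_integral_continuousMap f) fun mu => ?_
  refine LipschitzWith.of_dist_le_mul fun f g => ?_
  rw [dist_eq_norm, ← integral_sub f.continuous.integrable_of_compactSpace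
    g.continuous.integrable_of_compactSpace]
  refine (norm_integral_le_of_norm_le_const (C := dist f g) (ae_of_all _ fun y => ?_)).trans
    (by simp)
  rw [← dist_eq_norm]
  exact ContinuousMap.dist_apply_le_dist y

theorem continuous_uncurry_cost {X : Type*} [MetricSpace X] {C : X → X → ℝ}
    {kappa : ℝ≥0} (hCsym : ∀ x y, C x y = C y x)
    (hC : ∀ y, LipschitzWith kappa (fun x => C x y)) : Continuous (Function.uncurry C) := by
  refine (LipschitzWith.uncurry (Kβ := kappa) hC fun x => ?_).continuous
  rw [show C x = fun y => C y x from funext (hCsym x)]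
  exact hC x

theorem OTcost_eq_of_isMax {X : Type*} [TopologicalSpace X] [MeasurableSpace X] {eps : ℝ}
    {C : X → X → ℝ} {alpha beta : Measure X} {a b : X → ℝ} (ha : Continuous a)
    (hb : Continuous b)
    (hmax : ∀ f g : X → ℝ, Continuous f → Continuous g →
      Dfun eps C alpha beta f g ≤ Dfun eps C alpha beta a b) :
    OTcost eps C alpha beta = Dfun eps C alpha beta a b := by
  refine IsGreatest.csSup_eq ⟨⟨a, b, ha, hb, rfl⟩, ?_⟩
  rintro _ ⟨f, g, hf, hg, rfl⟩
  exact hmax f g hf hg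

theorem exists_abs_cost_le {X : Type*} [TopologicalSpace X] [CompactSpace X] {C : X → X → ℝ}
    (hC : Continuous (Function.uncurry C)) :
    ∃ B, ∀ x y, |C x y| ≤ B := by
  obtain ⟨B, hB⟩ := isCompact_univ.exists_bound_of_continuousOn hC.continuousOn
  exact ⟨B, fun x y => hB (x, y) trivial⟩

theorem integral_expMeasure {X : Type*} [TopologicalSpace X] [MeasurableSpace X] [BorelSpace X]
    {eps : ℝ} {alpha : Measure X} {a : X → ℝ} (ha : Continuous a) (F : X → ℝ) :
    ∫ x, F x ∂(expMeasure eps alpha a) = ∫ x, Real.exp (a x / eps) * F x ∂alpha := by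
  unfold expMeasure
  rw [integral_withDensity_eq_integral_toReal_smul
    (Continuous.measurable (by fun_prop)).ennreal_ofReal (ae_of_all _ fun x => ENNReal.ofReal_lt_top)]
  simp only [ENNReal.toReal_ofReal (Real.exp_pos _).le, smul_eq_mul]

theorem integral_kernel_expMeasure {X : Type*} [TopologicalSpace X] [MeasurableSpace X] [BorelSpace X]
    {eps : ℝ} {C : X → X → ℝ} {alpha : Measure X} {a : X → ℝ} (ha : Continuous a) (x : X) :
    ∫ y, Real.exp (-(C x y) / eps) ∂(expMeasure eps alpha a) = gibbsIntegral eps C alpha a x := by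
  rw [integral_expMeasure ha]
  simp only [gibbsIntegral, ← Real.exp_add]
  congr! 3
  ring

section Potentials

variable {X : Type*} [MetricSpace X] [CompactSpace X] [MeasurableSpace X] [BorelSpace X]
  {eps : ℝ} {C : X → X → ℝ} {kappa : ℝ≥0} {alpha beta : Measure X} {a b f g : X → ℝ}

theorem continuous_parametric_integral_of_compactSpace [IsFiniteMeasure beta]
    {F : X → X → ℝ} (hF : Continuous (Function.uncurry F)) :
    Continuous fun x => ∫ y, F x y ∂beta := by
  simpa using continuous_parametric_integral_of_continuous (μ := beta) hF isCompact_univ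

theorem continuous_gibbsIntegral [IsFiniteMeasure beta] (hC : Continuous (Function.uncurry C))
    (hg : Continuous g) : Continuous (gibbsIntegral eps C beta g) := by
  refine continuous_parametric_integral_of_compactSpace ?_
  have : Continuous fun p : X × X => C p.1 p.2 := hC
  simp only [Function.uncurry_def]
  fun_prop

theorem integrable_gibbs [IsFiniteMeasure beta] (hC : Continuous (Function.uncurry C))
    (hg : Continuous g) (x : X) : Integrable (fun y => Real.exp ((g y - C x y) / eps)) beta := by
  have : Continuous fun p : X × X => C p.1 p.2 := hC
  have : Continuous fun y => C x y := by fun_prop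
  exact Continuous.integrable_of_compactSpace (by fun_prop)

theorem gibbsIntegral_pos [IsProbabilityMeasure beta] (hC : Continuous (Function.uncurry C))
    (hg : Continuous g) (x : X) : 0 < gibbsIntegral eps C beta g x :=
  integral_exp_pos (integrable_gibbs hC hg x)

theorem continuous_sinkhornMap [IsProbabilityMeasure beta] (hC : Continuous (Function.uncurry C))
    (hg : Continuous g) : Continuous (sinkhornMap eps C beta g) :=
  continuous_const.mul ((continuous_gibbsIntegral hC hg).log
    fun x => (gibbsIntegral_pos hC hg x).ne')

theorem sinkhornMap_le_add [IsProbabilityMeasure beta] (heps : 0 < eps)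
    (hC : Continuous (Function.uncurry C)) (hg : Continuous g) {x x' : X} {δ : ℝ}
    (h : ∀ y, C x y ≤ C x' y + δ) :
    sinkhornMap eps C beta g x ≤ sinkhornMap eps C beta g x' + δ := by
  have key : gibbsIntegral eps C beta g x' ≤ Real.exp (δ / eps) * gibbsIntegral eps C beta g x := by
    unfold gibbsIntegral
    rw [← integral_const_mul]
    refine integral_mono (integrable_gibbs hC hg x')
      ((integrable_gibbs hC hg x).const_mul _) fun y => ?_
    simp only
    rw [← Real.exp_add, ← add_div]
    gcongr
    linarith [h y]
  have := Real.log_le_log (gibbsIntegral_pos hC hg x') key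
  rw [Real.log_mul (Real.exp_pos _).ne' (gibbsIntegral_pos hC hg x).ne', Real.log_exp] at this
  have h2 := mul_le_mul_of_nonneg_left this heps.le
  rw [mul_add, mul_div_cancel₀ _ heps.ne'] at h2
  unfold sinkhornMap
  linarith

theorem lipschitzWith_sinkhornMap [IsProbabilityMeasure beta] (heps : 0 < eps)
    (hC : Continuous (Function.uncurry C)) (hClip : ∀ y, LipschitzWith kappa (fun x => C x y))
    (hg : Continuous g) : LipschitzWith kappa (sinkhornMap eps C beta g) := by
  refine LipschitzWith.of_le_add_mul kappa fun x x' => ?_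
  exact sinkhornMap_le_add heps hC hg fun y => (hClip y).le_add_mul x x'

theorem abs_sinkhornMap_le [IsProbabilityMeasure beta] (heps : 0 < eps)
    (hC : Continuous (Function.uncurry C)) (hg : Continuous g) {A B : ℝ}
    (hA : ∀ x, |g x| ≤ A) (hB : ∀ x y, |C x y| ≤ B) (x : X) :
    |sinkhornMap eps C beta g x| ≤ A + B := by
  have hW := gibbsIntegral_pos (eps := eps) (beta := beta) hC hg x
  have h1 : gibbsIntegral eps C beta g x ≤ Real.exp ((A + B) / eps) := by
    refine (integral_mono (integrable_gibbs hC hg x) (integrable_const (Real.exp ((A + B) / eps))) fun y => ?_).trans_eq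
      (by simp)
    refine Real.exp_le_exp.2 (div_le_div_of_nonneg_right ?_ heps.le)
    linarith [(abs_le.1 (hA y)).2, (abs_le.1 (hB x y)).1]
  have h2 : Real.exp (-(A + B) / eps) ≤ gibbsIntegral eps C beta g x := by
    refine Eq.trans_le (by simp) (integral_mono (μ := beta)
      (integrable_const (Real.exp (-(A + B) / eps)))
      (integrable_gibbs hC hg x) fun y => ?_)
    refine Real.exp_le_exp.2 (div_le_div_of_nonneg_right ?_ heps.le)
    linarith [(abs_le.1 (hA y)).1, (abs_le.1 (hB x y)).2]
  rw [← Real.le_log_iff_exp_le hW, div_le_iff₀ heps] at h2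
  rw [← Real.log_le_iff_le_exp hW, le_div_iff₀ heps] at h1
  unfold sinkhornMap
  rw [abs_le]
  constructor <;> linarith

theorem Dfun_eq_gibbs [IsProbabilityMeasure alpha] [IsProbabilityMeasure beta]
    (hC : Continuous (Function.uncurry C)) (hf : Continuous f) (hg : Continuous g) :
    Dfun eps C alpha beta f g = (∫ y, g y ∂beta) + eps +
      ∫ x, (f x - eps * (Real.exp (f x / eps) * gibbsIntegral eps C beta g x)) ∂alpha := by
  have hW := continuous_gibbsIntegral (eps := eps) (beta := beta) hC hg
  have h1 : ∀ x, ∫ y, (Real.exp ((f x + g y - C x y) / eps) - 1) ∂beta =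
      Real.exp (f x / eps) * gibbsIntegral eps C beta g x - 1 := fun x => by
    have h : ∀ y, Real.exp ((f x + g y - C x y) / eps) =
        Real.exp (f x / eps) * Real.exp ((g y - C x y) / eps) := fun y => by
      rw [← Real.exp_add]; ring_nf
    simp only [h]
    rw [integral_sub ((integrable_gibbs hC hg x).const_mul _) (integrable_const _),
      integral_const_mul]
    simp [gibbsIntegral]
  unfold Dfun
  simp only [h1]
  have hi : Integrable (fun x => Real.exp (f x / eps) * gibbsIntegral eps C beta g x) alpha :=
    Continuous.integrable_of_compactSpace (by fun_prop)
  rw [integral_sub hi (integrable_const _),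
    integral_sub hf.integrable_of_compactSpace (hi.const_mul _), integral_const_mul]
  simp
  ring

theorem Dfun_swap [IsFiniteMeasure alpha] [IsFiniteMeasure beta]
    (hCsym : ∀ x y, C x y = C y x) (hC : Continuous (Function.uncurry C))
    (hf : Continuous f) (hg : Continuous g) :
    Dfun eps C alpha beta f g = Dfun eps C beta alpha g f := by
  have hC' : Continuous fun p : X × X => C p.1 p.2 := hC
  unfold Dfun
  rw [integral_integral_swap (Continuous.integrable_of_compactSpace
    (by simp only [Function.uncurry_def]; fun_prop)), add_comm (∫ x, f x ∂alpha)]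
  simp only [hCsym, add_comm]

theorem Dfun_shift [IsProbabilityMeasure alpha] [IsProbabilityMeasure beta]
    (hf : Continuous f) (hg : Continuous g) (c : ℝ) :
    Dfun eps C alpha beta (fun x => f x - c) (fun y => g y + c) = Dfun eps C alpha beta f g := by
  unfold Dfun
  rw [integral_sub hf.integrable_of_compactSpace (integrable_const _),
    integral_add hg.integrable_of_compactSpace (integrable_const _)]
  simp only [sub_add_add_cancel]
  simp

theorem exp_neg_mul_log_div_mul (heps : 0 < eps) {w : ℝ} (hw : 0 < w) :
    Real.exp (-eps * Real.log w / eps) * w = 1 := by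
  rw [neg_mul, neg_div, mul_div_cancel_left₀ _ heps.ne', Real.exp_neg, Real.exp_log hw,
    inv_mul_cancel₀ hw.ne']

theorem sub_exp_mul_le (heps : 0 < eps) {w : ℝ} (hw : 0 < w) (t : ℝ) :
    t - eps * (Real.exp (t / eps) * w) ≤
      -eps * Real.log w - eps * (Real.exp (-eps * Real.log w / eps) * w) := by
  rw [exp_neg_mul_log_div_mul heps hw]
  nth_rewrite 1 [← Real.exp_log hw]
  rw [← Real.exp_add]
  have h := mul_le_mul_of_nonneg_left (Real.add_one_le_exp (t / eps + Real.log w)) heps.le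
  have ht : eps * (t / eps) = t := mul_div_cancel₀ t heps.ne'
  linarith

theorem exp_mul_eq_one_of_le (heps : 0 < eps) {w : ℝ} (hw : 0 < w) {t : ℝ}
    (h : -eps * Real.log w - eps * (Real.exp (-eps * Real.log w / eps) * w) ≤
      t - eps * (Real.exp (t / eps) * w)) : Real.exp (t / eps) * w = 1 := by
  rw [exp_neg_mul_log_div_mul heps hw] at h
  nth_rewrite 1 [← Real.exp_log hw]
  nth_rewrite 2 [← Real.exp_log hw] at h
  rw [← Real.exp_add] at h ⊢
  have ht : eps * (t / eps) = t := mul_div_cancel₀ t heps.ne'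
  by_contra hne
  have hs : t / eps + Real.log w ≠ 0 := fun h0 => hne (by rw [h0, Real.exp_zero])
  have := mul_lt_mul_of_pos_left (Real.add_one_lt_exp hs) heps
  linarith

theorem integrable_sub_exp_mul_gibbs [IsFiniteMeasure alpha] [IsFiniteMeasure beta]
    (hC : Continuous (Function.uncurry C)) (hf : Continuous f) (hg : Continuous g) :
    Integrable (fun x => f x - eps * (Real.exp (f x / eps) * gibbsIntegral eps C beta g x))
      alpha := by
  have hW := continuous_gibbsIntegral (eps := eps) (beta := beta) hC hg
  exact Continuous.integrable_of_compactSpace (by fun_prop)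

theorem Dfun_le_sinkhornMap [IsProbabilityMeasure alpha] [IsProbabilityMeasure beta]
    (heps : 0 < eps) (hC : Continuous (Function.uncurry C)) (hf : Continuous f)
    (hg : Continuous g) :
    Dfun eps C alpha beta f g ≤ Dfun eps C alpha beta (sinkhornMap eps C beta g) g := by
  have hT := continuous_sinkhornMap (eps := eps) (beta := beta) hC hg
  rw [Dfun_eq_gibbs hC hf hg, Dfun_eq_gibbs hC hT hg]
  gcongr
  · exact integrable_sub_exp_mul_gibbs hC hf hg
  · exact integrable_sub_exp_mul_gibbs hC hT hg
  · intro x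
    exact sub_exp_mul_le heps (gibbsIntegral_pos hC hg x) _

theorem ae_exp_mul_gibbsIntegral_eq_one [IsProbabilityMeasure alpha] [IsProbabilityMeasure beta]
    (heps : 0 < eps) (hC : Continuous (Function.uncurry C)) (hf : Continuous f)
    (hg : Continuous g)
    (h : Dfun eps C alpha beta (sinkhornMap eps C beta g) g ≤ Dfun eps C alpha beta f g) :
    ∀ᵐ x ∂alpha, Real.exp (f x / eps) * gibbsIntegral eps C beta g x = 1 := by
  have hT := continuous_sinkhornMap (eps := eps) (beta := beta) hC hg
  have hle : ∀ x, f x - eps * (Real.exp (f x / eps) * gibbsIntegral eps C beta g x) ≤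
      sinkhornMap eps C beta g x - eps * (Real.exp (sinkhornMap eps C beta g x / eps) *
        gibbsIntegral eps C beta g x) :=
    fun x => sub_exp_mul_le heps (gibbsIntegral_pos hC hg x) _
  have hif := integrable_sub_exp_mul_gibbs (eps := eps) (alpha := alpha) (beta := beta) hC hf hg
  have hiT := integrable_sub_exp_mul_gibbs (eps := eps) (alpha := alpha) (beta := beta) hC hT hg
  rw [Dfun_eq_gibbs hC hf hg, Dfun_eq_gibbs hC hT hg, add_le_add_iff_left] at h
  have heq := (integral_eq_iff_of_ae_le hif hiT (ae_of_all _ hle)).1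
    (le_antisymm (integral_mono hif hiT hle) h)
  filter_upwards [heq] with x hx
  exact exp_mul_eq_one_of_le heps (gibbsIntegral_pos hC hg x) hx.ge

theorem exists_mem_potentialSet_Dfun_le [IsProbabilityMeasure alpha] [IsProbabilityMeasure beta]
    (heps : 0 < eps) (hCsym : ∀ x y, C x y = C y x)
    (hClip : ∀ y, LipschitzWith kappa (fun x => C x y)) {B : ℝ} (hB : ∀ x y, |C x y| ≤ B)
    (hf : Continuous f) (hg : Continuous g) :
    ∃ p ∈ potentialSet X kappa (kappa * Metric.diam (Set.univ : Set X) + B) ×ˢ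
        potentialSet X kappa (kappa * Metric.diam (Set.univ : Set X) + B),
      Dfun eps C alpha beta f g ≤ Dfun eps C alpha beta p.1 p.2 := by
  have hC := continuous_uncurry_cost hCsym hClip
  obtain ⟨x₀⟩ : Nonempty X := nonempty_of_isProbabilityMeasure alpha
  have hB0 : 0 ≤ B := (abs_nonneg _).trans (hB x₀ x₀)
  have hTlip := lipschitzWith_sinkhornMap (beta := beta) heps hC hClip hg
  set f₁ : X → ℝ := fun x => sinkhornMap eps C beta g x - sinkhornMap eps C beta g x₀ with hf₁
  have hf₁lip : LipschitzWith kappa f₁ := by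
    refine LipschitzWith.of_dist_le_mul fun x y => ?_
    simpa [hf₁] using hTlip.dist_le_mul x y
  have hf₁bd : ∀ x, |f₁ x| ≤ kappa * Metric.diam (Set.univ : Set X) := fun x => by
    refine (hTlip.dist_le_mul x x₀).trans ?_
    gcongr
    exact Metric.dist_le_diam_of_mem isCompact_univ.isBounded (Set.mem_univ _) (Set.mem_univ _)
  have hg₁lip := lipschitzWith_sinkhornMap (beta := alpha) heps hC hClip hf₁lip.continuous
  have hg₁bd := abs_sinkhornMap_le (beta := alpha) heps hC hf₁lip.continuous hf₁bd hB
  refine ⟨⟨⟨f₁, hf₁lip.continuous⟩, ⟨_, hg₁lip.continuous⟩⟩,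
    ⟨⟨hf₁lip, fun x => (hf₁bd x).trans (le_add_of_nonneg_right hB0)⟩, hg₁lip, hg₁bd⟩, ?_⟩
  have hg' : Continuous fun y => g y + sinkhornMap eps C beta g x₀ := by fun_prop
  calc Dfun eps C alpha beta f g
      ≤ Dfun eps C alpha beta (sinkhornMap eps C beta g) g := Dfun_le_sinkhornMap heps hC hf hg
    _ = Dfun eps C alpha beta f₁ (fun y => g y + sinkhornMap eps C beta g x₀) :=
      (Dfun_shift hTlip.continuous hg _).symm
    _ = Dfun eps C beta alpha (fun y => g y + sinkhornMap eps C beta g x₀) f₁ :=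
      Dfun_swap hCsym hC hf₁lip.continuous hg'
    _ ≤ Dfun eps C beta alpha (sinkhornMap eps C alpha f₁) f₁ :=
      Dfun_le_sinkhornMap heps hC hg' hf₁lip.continuous
    _ = Dfun eps C alpha beta f₁ (sinkhornMap eps C alpha f₁) :=
      Dfun_swap hCsym hC hg₁lip.continuous hf₁lip.continuous

theorem continuous_Dfun (hC : Continuous (Function.uncurry C)) :
    Continuous fun q : (ProbabilityMeasure X × ProbabilityMeasure X) × (C(X, ℝ) × C(X, ℝ)) =>
      Dfun eps C q.1.1 q.1.2 q.2.1 q.2.2 := by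
  have hC' : Continuous fun p : X × X => C p.1 p.2 := hC
  let Φ : C(X, ℝ) × C(X, ℝ) → C(X × X, ℝ) := fun p =>
    ⟨fun z => Real.exp ((p.1 z.1 + p.2 z.2 - C z.1 z.2) / eps) - 1, by fun_prop⟩
  have hΦ : Continuous Φ := by
    refine ContinuousMap.continuous_of_continuous_uncurry _ ?_
    simp only [Function.uncurry_def, Φ, ContinuousMap.coe_mk]
    fun_prop
  have hD : (fun q : (ProbabilityMeasure X × ProbabilityMeasure X) × (C(X, ℝ) × C(X, ℝ)) =>
      Dfun eps C q.1.1 q.1.2 q.2.1 q.2.2) = fun q => (∫ x, q.2.1 x ∂(q.1.1 : Measure X)) +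
      (∫ y, q.2.2 y ∂(q.1.2 : Measure X)) -
      eps * ∫ z, Φ q.2 z ∂((q.1.1.prod q.1.2 : ProbabilityMeasure (X × X)) : Measure (X × X)) := by
    ext q
    rw [ProbabilityMeasure.toMeasure_prod,
      integral_prod _ (Φ q.2).continuous.integrable_of_compactSpace]
    rfl
  rw [hD]
  have h1 := (continuous_integral_prod (Y := X)).comp
    (f := fun q : (ProbabilityMeasure X × ProbabilityMeasure X) × (C(X, ℝ) × C(X, ℝ)) =>
      (q.2.1, q.1.1)) (by fun_prop)
  have h2 := (continuous_integral_prod (Y := X)).comp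
    (f := fun q : (ProbabilityMeasure X × ProbabilityMeasure X) × (C(X, ℝ) × C(X, ℝ)) =>
      (q.2.2, q.1.2)) (by fun_prop)
  have h3 := (continuous_integral_prod (Y := X × X)).comp
    (f := fun q : (ProbabilityMeasure X × ProbabilityMeasure X) × (C(X, ℝ) × C(X, ℝ)) =>
      (Φ q.2, q.1.1.prod q.1.2)) ((hΦ.comp continuous_snd).prodMk
        (ProbabilityMeasure.continuous_prod.comp continuous_fst))
  exact (h1.add h2).sub (continuous_const.mul h3)

theorem exists_mem_potentialSet_isMax [IsProbabilityMeasure alpha] [IsProbabilityMeasure beta]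
    (heps : 0 < eps) (hCsym : ∀ x y, C x y = C y x)
    (hClip : ∀ y, LipschitzWith kappa (fun x => C x y)) {B : ℝ} (hB : ∀ x y, |C x y| ≤ B) :
    ∃ p ∈ potentialSet X kappa (kappa * Metric.diam (Set.univ : Set X) + B) ×ˢ
        potentialSet X kappa (kappa * Metric.diam (Set.univ : Set X) + B),
      ∀ f g : X → ℝ, Continuous f → Continuous g →
        Dfun eps C alpha beta f g ≤ Dfun eps C alpha beta p.1 p.2 := by
  have hD : Continuous fun p : C(X, ℝ) × C(X, ℝ) => Dfun eps C alpha beta p.1 p.2 :=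
    (continuous_Dfun (eps := eps) (continuous_uncurry_cost hCsym hClip)).comp
      (f := fun p : C(X, ℝ) × C(X, ℝ) =>
        (((⟨alpha, ‹_›⟩, ⟨beta, ‹_›⟩) : ProbabilityMeasure X × ProbabilityMeasure X), p))
      (by fun_prop)
  obtain ⟨p₀, hp₀, -⟩ := exists_mem_potentialSet_Dfun_le (alpha := alpha) (beta := beta)
    heps hCsym hClip hB (continuous_const (y := (0 : ℝ))) (continuous_const (y := (0 : ℝ)))
  obtain ⟨p, hp, hmax⟩ := ((isCompact_potentialSet (X := X) kappa _).prod
    (isCompact_potentialSet kappa _)).exists_isMaxOn ⟨p₀, hp₀⟩ hD.continuousOn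
  refine ⟨p, hp, fun f g hf hg => ?_⟩
  obtain ⟨q, hq, hle⟩ := exists_mem_potentialSet_Dfun_le (alpha := alpha) (beta := beta)
    heps hCsym hClip hB hf hg
  exact hle.trans (hmax hq)

theorem Dfun_le_OTcost [IsProbabilityMeasure alpha] [IsProbabilityMeasure beta]
    (heps : 0 < eps) (hCsym : ∀ x y, C x y = C y x)
    (hClip : ∀ y, LipschitzWith kappa (fun x => C x y)) (hf : Continuous f) (hg : Continuous g) :
    Dfun eps C alpha beta f g ≤ OTcost eps C alpha beta := by
  obtain ⟨B, hB⟩ := exists_abs_cost_le (continuous_uncurry_cost hCsym hClip)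
  obtain ⟨p, -, hmax⟩ := exists_mem_potentialSet_isMax (alpha := alpha) (beta := beta)
    heps hCsym hClip hB
  rw [OTcost_eq_of_isMax p.1.continuous p.2.continuous hmax]
  exact hmax f g hf hg

theorem continuous_OTcost (heps : 0 < eps) (hCsym : ∀ x y, C x y = C y x)
    (hClip : ∀ y, LipschitzWith kappa (fun x => C x y)) :
    Continuous fun q : ProbabilityMeasure X × ProbabilityMeasure X =>
      OTcost eps C q.1 q.2 := by
  have hC := continuous_uncurry_cost hCsym hClip
  obtain ⟨B, hB⟩ := exists_abs_cost_le hC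
  set K := potentialSet X kappa (kappa * Metric.diam (Set.univ : Set X) + B)
  have hK : IsCompact (K ×ˢ K) := (isCompact_potentialSet kappa _).prod (isCompact_potentialSet _ _)
  convert hK.continuous_sSup (f := fun (q : ProbabilityMeasure X × ProbabilityMeasure X)
    (p : C(X, ℝ) × C(X, ℝ)) => Dfun eps C q.1 q.2 p.1 p.2) (continuous_Dfun hC) using 2 with q
  obtain ⟨p, hp, hmax⟩ := exists_mem_potentialSet_isMax (alpha := (q.1 : Measure X))
    (beta := (q.2 : Measure X)) heps hCsym hClip hB
  rw [OTcost_eq_of_isMax p.1.continuous p.2.continuous hmax]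
  symm
  refine IsGreatest.csSup_eq (s := (fun p : C(X, ℝ) × C(X, ℝ) =>
    Dfun eps C q.1 q.2 p.1 p.2) '' (K ×ˢ K)) ⟨⟨p, hp, rfl⟩, ?_⟩
  rintro _ ⟨p', -, rfl⟩
  exact hmax _ _ p'.1.continuous p'.2.continuous

theorem exp_half_add_le (s t : ℝ) :
    Real.exp ((s + t) / 2) ≤ (Real.exp s + Real.exp t) / 2 := by
  have hs : Real.exp s = Real.exp (s / 2) ^ 2 := by rw [← Real.exp_nat_mul]; ring_nf
  have ht : Real.exp t = Real.exp (t / 2) ^ 2 := by rw [← Real.exp_nat_mul]; ring_nf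
  rw [add_div, Real.exp_add, hs, ht]
  nlinarith [sq_nonneg (Real.exp (s / 2) - Real.exp (t / 2))]

theorem Dfun_le_symmetrize [IsProbabilityMeasure alpha] (heps : 0 < eps)
    (hCsym : ∀ x y, C x y = C y x) (hC : Continuous (Function.uncurry C))
    (hf : Continuous f) (hg : Continuous g) :
    Dfun eps C alpha alpha f g ≤
      Dfun eps C alpha alpha (fun x => (f x + g x) / 2) (fun x => (f x + g x) / 2) := by
  have hC' : Continuous fun p : X × X => C p.1 p.2 := hC
  have hexp : ∀ {u v : X → ℝ}, Continuous u → Continuous v → Integrable (fun z : X × X =>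
      Real.exp ((u z.1 + v z.2 - C z.1 z.2) / eps) - 1) (alpha.prod alpha) :=
    fun hu hv => Continuous.integrable_of_compactSpace (by fun_prop)
  have hprod : ∀ {u v : X → ℝ}, Continuous u → Continuous v → Dfun eps C alpha alpha u v =
      (∫ x, u x ∂alpha) + (∫ x, v x ∂alpha) - eps * ∫ z : X × X,
        (Real.exp ((u z.1 + v z.2 - C z.1 z.2) / eps) - 1) ∂(alpha.prod alpha) := by
    intro u v hu hv
    rw [integral_prod _ (hexp hu hv)]
    rfl
  have hh : Continuous fun x => (f x + g x) / 2 := by fun_prop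
  have hswap := Dfun_swap (eps := eps) (alpha := alpha) (beta := alpha) hCsym hC hf hg
  have hconv := integral_mono (hexp hh hh) (((hexp hf hg).add (hexp hg hf)).div_const 2) fun z => by
    have := exp_half_add_le ((f z.1 + g z.2 - C z.1 z.2) / eps)
      ((g z.1 + f z.2 - C z.1 z.2) / eps)
    rw [show ((f z.1 + g z.2 - C z.1 z.2) / eps + (g z.1 + f z.2 - C z.1 z.2) / eps) / 2 =
      ((f z.1 + g z.1) / 2 + (f z.2 + g z.2) / 2 - C z.1 z.2) / eps by ring] at this
    simp only [Pi.add_apply]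
    linarith
  simp only [Pi.add_apply] at hconv
  rw [integral_div, integral_add (hexp hf hg) (hexp hg hf)] at hconv
  have hlin : ∫ x, (f x + g x) / 2 ∂alpha = ((∫ x, f x ∂alpha) + ∫ x, g x ∂alpha) / 2 := by
    rw [integral_div, integral_add hf.integrable_of_compactSpace hg.integrable_of_compactSpace]
  rw [hprod hf hg, hprod hg hf] at hswap
  rw [hprod hf hg, hprod hh hh, hlin]
  have := mul_le_mul_of_nonneg_left hconv heps.le
  linarith

/-- Existence of a symmetric optimal potential for `OT_ε(α, α)`. -/
theorem exists_symmetric_potential [IsProbabilityMeasure alpha]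
    (heps : 0 < eps) (hCsym : ∀ x y, C x y = C y x)
    (hClip : ∀ y, LipschitzWith kappa (fun x => C x y)) :
    ∃ a : X → ℝ, Continuous a ∧ OTcost eps C alpha alpha = Dfun eps C alpha alpha a a ∧
      ∀ᵐ x ∂alpha, Real.exp (a x / eps) * gibbsIntegral eps C alpha a x = 1 := by
  have hC := continuous_uncurry_cost hCsym hClip
  obtain ⟨B, hB⟩ := exists_abs_cost_le hC
  obtain ⟨p, -, hmax⟩ := exists_mem_potentialSet_isMax (alpha := alpha) (beta := alpha)
    heps hCsym hClip hB
  have ha : Continuous fun x => (p.1 x + p.2 x) / 2 := by fun_prop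
  have hmax' := fun f g hf hg => (hmax f g hf hg).trans
    (Dfun_le_symmetrize heps hCsym hC p.1.continuous p.2.continuous)
  exact ⟨_, ha, OTcost_eq_of_isMax ha ha hmax', ae_exp_mul_gibbsIntegral_eq_one heps hC ha ha
    (hmax' _ _ (continuous_sinkhornMap hC ha) ha)⟩

theorem isFiniteMeasure_expMeasure [IsFiniteMeasure alpha] (ha : Continuous a) :
    IsFiniteMeasure (expMeasure eps alpha a) :=
  isFiniteMeasure_withDensity_ofReal
    (Continuous.integrable_of_compactSpace (by fun_prop)).hasFiniteIntegral

theorem Dfun_eq_kernel [IsProbabilityMeasure alpha] [IsProbabilityMeasure beta]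
    (hC : Continuous (Function.uncurry C)) (ha : Continuous a) (hb : Continuous b) :
    Dfun eps C alpha beta a b = (∫ x, a x ∂alpha) + (∫ y, b y ∂beta) + eps -
      eps * ∫ x, ∫ y, Real.exp (-(C x y) / eps) ∂(expMeasure eps beta b)
        ∂(expMeasure eps alpha a) := by
  have hW := continuous_gibbsIntegral (eps := eps) (beta := beta) hC hb
  rw [Dfun_eq_gibbs hC ha hb, integral_expMeasure ha]
  simp only [integral_kernel_expMeasure hb]
  rw [integral_sub ha.integrable_of_compactSpace
    (Continuous.integrable_of_compactSpace (by fun_prop)), integral_const_mul]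
  ring

theorem kerQuad_le_Sinkhorn [IsProbabilityMeasure alpha] [IsProbabilityMeasure beta]
    (heps : 0 < eps) (hCsym : ∀ x y, C x y = C y x)
    (hClip : ∀ y, LipschitzWith kappa (fun x => C x y)) (ha : Continuous a) (hb : Continuous b)
    (hOTa : OTcost eps C alpha alpha = Dfun eps C alpha alpha a a)
    (hOTb : OTcost eps C beta beta = Dfun eps C beta beta b b) :
    eps / 2 * kerQuad (fun x y => Real.exp (-(C x y) / eps)) (expMeasure eps alpha a)
      (expMeasure eps beta b) ≤ Sinkhorn eps C alpha beta := by
  have hC := continuous_uncurry_cost hCsym hClip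
  have hab := Dfun_le_OTcost (alpha := alpha) (beta := beta) heps hCsym hClip ha hb
  have hba := (Dfun_swap (eps := eps) (alpha := alpha) (beta := beta) hCsym hC ha hb).symm
  rw [Dfun_eq_kernel hC hb ha, Dfun_eq_kernel hC ha hb] at hba
  rw [Dfun_eq_kernel hC ha hb] at hab
  unfold Sinkhorn kerQuad
  rw [hOTa, hOTb, Dfun_eq_kernel hC ha ha, Dfun_eq_kernel hC hb hb]
  linarith

theorem withDensity_integral_kernel_expMeasure (ha : Continuous a) [IsFiniteMeasure alpha]
    (hC : Continuous (Function.uncurry C))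
    (h : ∀ᵐ x ∂alpha, Real.exp (a x / eps) * gibbsIntegral eps C alpha a x = 1) :
    (expMeasure eps alpha a).withDensity (fun x => ENNReal.ofReal
      (∫ y, Real.exp (-(C x y) / eps) ∂(expMeasure eps alpha a))) = alpha := by
  have hW := continuous_gibbsIntegral (eps := eps) (beta := alpha) hC ha
  simp only [integral_kernel_expMeasure ha]
  unfold expMeasure
  rw [← withDensity_mul _ (Continuous.measurable (by fun_prop)).ennreal_ofReal
    (Continuous.measurable (by fun_prop)).ennreal_ofReal]
  conv_rhs => rw [← withDensity_one (μ := alpha)]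
  refine withDensity_congr_ae ?_
  filter_upwards [h] with x hx
  simp only [Pi.mul_apply, Pi.one_apply]
  rw [← ENNReal.ofReal_mul (Real.exp_pos _).le, hx, ENNReal.ofReal_one]

theorem eq_of_Sinkhorn_eq_zero [IsProbabilityMeasure alpha] [IsProbabilityMeasure beta]
    (heps : 0 < eps) (hCsym : ∀ x y, C x y = C y x)
    (hClip : ∀ y, LipschitzWith kappa (fun x => C x y))
    (hpd : StrictPosDef (fun x y => Real.exp (-(C x y) / eps)))
    (h : Sinkhorn eps C alpha beta = 0) : alpha = beta := by
  have hC := continuous_uncurry_cost hCsym hClip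
  obtain ⟨a, ha, hOTa, haea⟩ := exists_symmetric_potential (alpha := alpha) heps hCsym hClip
  obtain ⟨b, hb, hOTb, haeb⟩ := exists_symmetric_potential (alpha := beta) heps hCsym hClip
  have hle := kerQuad_le_Sinkhorn heps hCsym hClip ha hb hOTa hOTb
  have heq : expMeasure eps alpha a = expMeasure eps beta b := by
    by_contra hne
    have hpos := hpd _ _ (isFiniteMeasure_expMeasure ha) (isFiniteMeasure_expMeasure hb) hne
    have := mul_pos (half_pos heps) hpos
    linarith
  rw [← withDensity_integral_kernel_expMeasure ha hC haea, heq,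
    withDensity_integral_kernel_expMeasure hb hC haeb]

theorem continuous_Sinkhorn [IsProbabilityMeasure beta] (heps : 0 < eps)
    (hCsym : ∀ x y, C x y = C y x) (hClip : ∀ y, LipschitzWith kappa (fun x => C x y)) :
    Continuous fun mu : ProbabilityMeasure X => Sinkhorn eps C mu beta := by
  have hOT := continuous_OTcost heps hCsym hClip
  exact ((hOT.comp (f := fun mu : ProbabilityMeasure X =>
      ((mu, ⟨beta, ‹_›⟩) : ProbabilityMeasure X × ProbabilityMeasure X)) (by fun_prop)).sub
    (continuous_const.mul (hOT.comp (f := fun mu : ProbabilityMeasure X => (mu, mu))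
      (by fun_prop)))).sub continuous_const

end Potentials

/-- The Sinkhorn divergence metrizes the convergence in law:
`α_n ⇀ α` if and only if `S_ε(α_n, α) → 0`. -/
theorem sinkhorn_metrizes_weak_convergence
    {X : Type*} [MetricSpace X] [CompactSpace X] [MeasurableSpace X] [BorelSpace X]
    (eps : ℝ) (heps : 0 < eps) (C : X → X → ℝ) (kappa : ℝ≥0) (hkappa : 0 < kappa)
    (hCsym : ∀ x y, C x y = C y x)
    (hClip1 : ∀ y, LipschitzWith kappa (fun x => C x y))
    (hClip2 : ∀ x, LipschitzWith kappa (fun y => C x y))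
    (hpd : StrictPosDef (fun x y => Real.exp (-(C x y) / eps)))
    (alpha : ℕ → Measure X) (alphaLim : Measure X)
    [∀ n, IsProbabilityMeasure (alpha n)] [IsProbabilityMeasure alphaLim] :
    (∀ f : X → ℝ, Continuous f →
        Tendsto (fun n => ∫ x, f x ∂(alpha n)) atTop (𝓝 (∫ x, f x ∂alphaLim)))
      ↔ Tendsto (fun n => Sinkhorn eps C (alpha n) alphaLim) atTop (𝓝 0) := by
  let mu : ℕ → ProbabilityMeasure X := fun n => ⟨alpha n, inferInstance⟩
  let muLim : ProbabilityMeasure X := ⟨alphaLim, inferInstance⟩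
  have hS := continuous_Sinkhorn (beta := alphaLim) heps hCsym hClip1
  have hself : Sinkhorn eps C alphaLim alphaLim = 0 := by unfold Sinkhorn; ring
  have hweak : (∀ f : X → ℝ, Continuous f →
      Tendsto (fun n => ∫ x, f x ∂(alpha n)) atTop (𝓝 (∫ x, f x ∂alphaLim))) ↔
      Tendsto mu atTop (𝓝 muLim) := by
    rw [ProbabilityMeasure.tendsto_iff_forall_integral_tendsto]
    exact ⟨fun h f => h f f.continuous,
      fun h f hf => h (BoundedContinuousFunction.mkOfCompact ⟨f, hf⟩)⟩
  rw [hweak]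
  refine ⟨fun h => ?_, fun h => tendsto_nhds_of_unique_mapClusterPt fun nu hnu => ?_⟩
  · have hlim : Tendsto (fun nu : ProbabilityMeasure X => Sinkhorn eps C nu alphaLim)
        (𝓝 muLim) (𝓝 (Sinkhorn eps C alphaLim alphaLim)) := hS.tendsto muLim
    have hcomp := hlim.comp h
    rw [hself] at hcomp
    exact hcomp
  · have hcl := hnu.continuousAt_comp hS.continuousAt
    have hne : (𝓝 (Sinkhorn eps C nu alphaLim) ⊓ 𝓝 0).NeBot := ClusterPt.mono hcl h
    have hzero : Sinkhorn eps C (nu : Measure X) alphaLim = 0 := eq_of_nhds_neBot hne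
    have heq : (nu : Measure X) = alphaLim :=
      eq_of_Sinkhorn_eq_zero heps hCsym hClip1 hpd hzero
    exact Subtype.ext heq
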